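/- arXiv:2507.07770 — 8 statements merged into one kernel-verified Lean document; each statement's English description precedes it below -/
import Mathlib

section
/- Let μ and μ̂ be probability measures on ℝ supported in a compact interval [a,b] with CDFs F and F̂, and let x* ∈ (a,b). If μ̂ dominates μ in polarization around x* and μ ≠ μ̂, then P(F̂,x*) > P(F,x*). (Strictness follows because if F̂(x₀) ≠ F(x₀) at some point x₀, right-continuity of CDFs gives an interval of positive length on which F̂ − F has a constant nonzero sign consistent with the dominance condition.) -/
open MeasureTheory

/-- The degree of polarization of a distribution with CDF `F`, supported in `[a,b]`,
around the central point `xs`. -/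
noncomputable def polarizationDegree (F : ℝ → ℝ) (a b xs : ℝ) : ℝ :=
  (∫ x in a..xs, F x) / (xs - a) - (∫ x in xs..b, F x) / (b - xs) + 1

theorem aux_integral_lt (f g : StieltjesFunction ℝ) (p q c : ℝ) (hpc : p ≤ c) (hcq : c < q)
    (hle : ∀ x ∈ Set.Ioo p q, f x ≤ g x) (hlt : f c < g c) :
    (∫ x in p..q, f x) < ∫ x in p..q, g x := by
  have hpq : p < q := lt_of_le_of_lt hpc hcq
  apply intervalIntegral.integral_lt_integral_of_ae_le_of_measure_setOfPred_lt_ne_zero hpq.le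
    f.mono.intervalIntegrable g.mono.intervalIntegrable
  · rw [← restrict_Ioo_eq_restrict_Ioc]
    exact (ae_restrict_iff' measurableSet_Ioo).2 (Filter.Eventually.of_forall hle)
  · have hev : ∀ᶠ x in nhdsWithin c (Set.Ici c), f x < g x :=
      (f.right_continuous c).eventually_lt (g.right_continuous c) hlt
    obtain ⟨d, hd, hsub⟩ := (mem_nhdsGE_iff_exists_Ico_subset).1 hev
    have hd' : c < d := hd
    intro h0
    have hm : c < min d q := lt_min hd' hcq
    have hs : Set.Ioo c (min d q) ⊆ {x | f x < g x} := fun x hx =>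
      hsub ⟨hx.1.le, lt_of_lt_of_le hx.2 (min_le_left _ _)⟩
    have h1 := measure_mono_null hs h0
    rw [Measure.restrict_apply measurableSet_Ioo, Set.inter_eq_left.2, Real.volume_Ioo] at h1
    · rw [ENNReal.ofReal_eq_zero] at h1
      linarith
    · intro x hx
      exact ⟨lt_of_le_of_lt hpc hx.1, (lt_of_lt_of_le hx.2 (min_le_right _ _)).le⟩

theorem aux_cdf_eq (μ : Measure ℝ) [IsProbabilityMeasure μ] (a b x : ℝ)
    (h : μ (Set.Icc a b)ᶜ = 0) :
    (x < a → μ (Set.Iic x) = 0) ∧ (b ≤ x → μ (Set.Iic x) = 1) := by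
  constructor
  · intro hx
    refine measure_mono_null ?_ h
    intro y hy hy'
    have h1 : y ≤ x := hy
    linarith [hy'.1]
  · intro hx
    rw [prob_compl_eq_zero_iff measurableSet_Icc] at h
    refine le_antisymm prob_le_one ?_
    rw [← h]
    exact measure_mono fun y hy => le_trans hy.2 hx

/-- If `ν` dominates `μ` in polarization around `xs` and `μ ≠ ν`, then
the degree of polarization of `ν` around `xs` is strictly greater than that of `μ`. -/
theorem polarizationDegree_lt_of_dominates_of_ne
    (μ ν : Measure ℝ) [IsProbabilityMeasure μ] [IsProbabilityMeasure ν]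
    (a b xs : ℝ) (hab : a < b) (hxs : xs ∈ Set.Ioo a b)
    (hsuppμ : μ (Set.Icc a b)ᶜ = 0) (hsuppν : ν (Set.Icc a b)ᶜ = 0)
    (F Fh : ℝ → ℝ)
    (hF : ∀ x, F x = (μ (Set.Iic x)).toReal)
    (hFh : ∀ x, Fh x = (ν (Set.Iic x)).toReal)
    (hdom₁ : ∀ x : ℝ, x < xs → F x ≤ Fh x)
    (hdom₂ : ∀ x : ℝ, xs ≤ x → Fh x ≤ F x)
    (hne : μ ≠ ν) :
    polarizationDegree F a b xs < polarizationDegree Fh a b xs := by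
  obtain rfl : F = ProbabilityTheory.cdf μ := by
    funext x; rw [hF, ProbabilityTheory.cdf_eq_real]; rfl
  obtain rfl : Fh = ProbabilityTheory.cdf ν := by
    funext x; rw [hFh, ProbabilityTheory.cdf_eq_real]; rfl
  obtain ⟨c, hc⟩ : ∃ c, ProbabilityTheory.cdf μ c ≠ ProbabilityTheory.cdf ν c := by
    by_contra! hcon
    exact hne (Measure.eq_of_cdf μ ν (StieltjesFunction.ext hcon))
  have hac : a ≤ c := by
    by_contra! hlt
    apply hc
    rw [hF, hFh, (aux_cdf_eq μ a b c hsuppμ).1 hlt, (aux_cdf_eq ν a b c hsuppν).1 hlt]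
  have hcb : c < b := by
    by_contra! hle
    apply hc
    rw [hF, hFh, (aux_cdf_eq μ a b c hsuppμ).2 hle, (aux_cdf_eq ν a b c hsuppν).2 hle]
  have hmono : ∀ (ρ : Measure ℝ) (p q : ℝ),
      IntervalIntegrable (ProbabilityTheory.cdf ρ) volume p q := fun ρ p q =>
    (ProbabilityTheory.cdf ρ).mono.intervalIntegrable
  have h1 : 0 < xs - a := sub_pos.2 hxs.1
  have h2 : 0 < b - xs := sub_pos.2 hxs.2
  unfold polarizationDegree
  rcases lt_or_ge c xs with hcx | hcx
  · have i1 := aux_integral_lt (ProbabilityTheory.cdf μ) (ProbabilityTheory.cdf ν) a xs c hac hcx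
      (fun x hx => hdom₁ x hx.2) (lt_of_le_of_ne (hdom₁ c hcx) hc)
    have i2 := intervalIntegral.integral_mono_on hxs.2.le (hmono ν xs b) (hmono μ xs b)
      (fun x hx => hdom₂ x hx.1)
    have j1 := div_lt_div_of_pos_right i1 h1
    have j2 := div_le_div_of_nonneg_right i2 h2.le
    linarith
  · have i1 := aux_integral_lt (ProbabilityTheory.cdf ν) (ProbabilityTheory.cdf μ) xs b c hcx hcb
      (fun x hx => hdom₂ x hx.1.le) (lt_of_le_of_ne (hdom₂ c hcx) hc.symm)
    have i2 := intervalIntegral.integral_mono_on_of_le_Ioo hxs.1.le (hmono μ a xs) (hmono ν a xs)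
      (fun x hx => hdom₁ x hx.2)
    have j1 := div_lt_div_of_pos_right i1 h2
    have j2 := div_le_div_of_nonneg_right i2 h1.le
    linarith
end

section
/- Let μ and μ̂ be probability measures on ℝ supported in a compact interval [a,b] with CDFs F and F̂, let x* ∈ (a,b), and suppose μ̂ dominates μ in polarization around x*. If μ and μ̂ have the same mean (∫ x dμ = ∫ x dμ̂), then μ̂ is a mean-preserving spread of μ, that is, ∫_a^t F̂(x) dx ≥ ∫_a^t F(x) dx for every t ∈ [a,b], with equality at t = b. -/
open MeasureTheory

lemma integral_cdf_aux (μ : Measure ℝ) [IsProbabilityMeasure μ] (a b : ℝ) (hab : a < b)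
    (hs : μ (Set.Icc a b)ᶜ = 0) (F : ℝ → ℝ) (hF : ∀ x, F x = (μ (Set.Iic x)).toReal) :
    ∫ x in a..b, F x = b - ∫ x, x ∂μ := by
  have hae : ∀ᵐ x ∂μ, x ∈ Set.Icc a b := mem_ae_iff.mpr hs
  have hint : Integrable (fun x : ℝ => x) μ := by
    refine Integrable.of_bound (C := max |a| |b|) (by fun_prop) ?_
    filter_upwards [hae] with x hx
    exact abs_le_max_abs_abs hx.1 hx.2
  have h1 : ∫ x, (b - x) ∂μ = b - ∫ x, x ∂μ := by
    rw [integral_sub (integrable_const b) hint]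
    simp
  have h2 := Integrable.integral_eq_integral_Ioc_meas_le (μ := μ) (f := fun x : ℝ => b - x)
    (M := b - a) ((integrable_const b).sub hint)
    (by filter_upwards [hae] with x hx using sub_nonneg.mpr hx.2)
    (by filter_upwards [hae] with x hx using by linarith [hx.1])
  rw [← h1, h2, ← intervalIntegral.integral_of_le (by linarith)]
  have h3 := intervalIntegral.integral_comp_sub_left (a := 0) (b := b - a) F b
  simp only [sub_sub_cancel, sub_zero] at h3
  rw [← h3]
  congr 1
  ext t
  rw [hF, Measure.real]
  congr 2
  ext x
  simp only [Set.mem_Iic, Set.mem_setOf_eq]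
  exact le_sub_comm

lemma cdf_intervalIntegrable_aux (μ : Measure ℝ) [IsProbabilityMeasure μ] (F : ℝ → ℝ)
    (hF : ∀ x, F x = (μ (Set.Iic x)).toReal) (a b : ℝ) : IntervalIntegrable F volume a b := by
  apply Monotone.intervalIntegrable
  intro x y hxy
  rw [hF, hF]
  exact ENNReal.toReal_mono (measure_ne_top _ _) (measure_mono (Set.Iic_subset_Iic.mpr hxy))

/-- If `ν` dominates `μ` in polarization around `xs ∈ (a,b)`, both
measures are supported in `[a,b]`, and they have the same mean, then `ν` is a
mean-preserving spread of `μ`: `∫_a^t F̂ ≥ ∫_a^t F` for every `t ∈ [a,b]`, with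
equality at `t = b`. -/
theorem mean_preserving_spread_of_dominates
    (μ ν : Measure ℝ) [IsProbabilityMeasure μ] [IsProbabilityMeasure ν]
    (a b xs : ℝ) (hab : a < b) (hxs : xs ∈ Set.Ioo a b)
    (hsuppμ : μ (Set.Icc a b)ᶜ = 0) (hsuppν : ν (Set.Icc a b)ᶜ = 0)
    (F Fh : ℝ → ℝ)
    (hF : ∀ x, F x = (μ (Set.Iic x)).toReal)
    (hFh : ∀ x, Fh x = (ν (Set.Iic x)).toReal)
    (hdom₁ : ∀ x : ℝ, x < xs → F x ≤ Fh x)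
    (hdom₂ : ∀ x : ℝ, xs ≤ x → Fh x ≤ F x)
    (hmean : ∫ x, x ∂μ = ∫ x, x ∂ν) :
    (∀ t ∈ Set.Icc a b, ∫ x in a..t, F x ≤ ∫ x in a..t, Fh x) ∧
      (∫ x in a..b, Fh x) = ∫ x in a..b, F x := by
  have hi := cdf_intervalIntegrable_aux μ F hF
  have hih := cdf_intervalIntegrable_aux ν Fh hFh
  have heq : (∫ x in a..b, Fh x) = ∫ x in a..b, F x := by
    rw [integral_cdf_aux μ a b hab hsuppμ F hF, integral_cdf_aux ν a b hab hsuppν Fh hFh, hmean]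
  refine ⟨fun t ht => ?_, heq⟩
  rcases le_or_gt t xs with h | h
  · refine intervalIntegral.integral_mono_on_of_le_Ioo ht.1 (hi a t) (hih a t) ?_
    intro x hx
    exact hdom₁ x (hx.2.trans_le h)
  · have h1 : ∫ x in t..b, Fh x ≤ ∫ x in t..b, F x := by
      refine intervalIntegral.integral_mono_on ht.2 (hih t b) (hi t b) ?_
      intro x hx
      exact hdom₂ x (h.le.trans hx.1)
    have h2 := intervalIntegral.integral_add_adjacent_intervals (hi a t) (hi t b)
    have h3 := intervalIntegral.integral_add_adjacent_intervals (hih a t) (hih t b)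
    linarith
end

section
/- Let μ and μ̂ be probability measures on ℝ with CDFs F and F̂, let x* ∈ ℝ, and suppose μ̂ dominates μ in polarization around x*. Let h : ℝ → ℝ be a bounded, nonnegative, nonincreasing function. Then ∫_{(-∞,x*)} h(x) dμ(x) ≤ ∫_{(-∞,x*)} h(x) dμ̂(x). -/
open MeasureTheory

/-- Comparison of the two measures on lower sets contained in the open half-line. -/
theorem measure_lower_le (μ ν : Measure ℝ) (xs : ℝ)
    (hle : ∀ x : ℝ, x < xs → μ (Set.Iic x) ≤ ν (Set.Iic x))
    (S : Set ℝ) (hS : IsLowerSet S) (hsub : S ⊆ Set.Iio xs) : μ S ≤ ν S := by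
  rcases S.eq_empty_or_nonempty with rfl | hne
  · simp
  have hb : BddAbove S := ⟨xs, fun x hx => (hsub hx).le⟩
  by_cases hm : sSup S ∈ S
  · have e : S = Set.Iic (sSup S) :=
      Set.Subset.antisymm (fun x hx => le_csSup hb hx) (fun x hx => hS hx hm)
    have := hle _ (hsub hm)
    rwa [← e] at this
  · have e : S = Set.Iio (sSup S) := by
      apply Set.Subset.antisymm
      · intro x hx
        exact lt_of_le_of_ne (le_csSup hb hx) (fun h => hm (h ▸ hx))
      · intro x hx
        obtain ⟨y, hy, hxy⟩ := exists_lt_of_lt_csSup hne hx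
        exact hS hxy.le hy
    have hsx : sSup S ≤ xs := csSup_le hne (fun x hx => (hsub hx).le)
    obtain ⟨u, hu, hlt, ht⟩ := exists_seq_strictMono_tendsto (sSup S)
    have e2 : S = ⋃ n, Set.Iic (u n) := by
      rw [e]
      ext x
      simp only [Set.mem_iUnion, Set.mem_Iic, Set.mem_Iio]
      constructor
      · intro hx
        obtain ⟨n, hn⟩ := (ht.eventually (lt_mem_nhds hx)).exists
        exact ⟨n, hn.le⟩
      · rintro ⟨n, hn⟩
        exact hn.trans_lt (hlt n)
    have mono : Monotone fun n => Set.Iic (u n) :=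
      fun a b hab => Set.Iic_subset_Iic.2 (hu.monotone hab)
    rw [e2, mono.measure_iUnion, mono.measure_iUnion]
    exact iSup_mono fun n => hle _ ((hlt n).trans_le hsx)

/-- If `ν` dominates `μ` in polarization around `xs`, and
`h : ℝ → ℝ` is bounded, nonnegative and nonincreasing, then the integral of `h`
over `(-∞, xs)` with respect to `μ` is at most that with respect to `ν`. -/
theorem integral_left_le_of_dominates
    (μ ν : Measure ℝ) [IsProbabilityMeasure μ] [IsProbabilityMeasure ν]
    (xs : ℝ) (F Fh : ℝ → ℝ)
    (hF : ∀ x, F x = (μ (Set.Iic x)).toReal)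
    (hFh : ∀ x, Fh x = (ν (Set.Iic x)).toReal)
    (hdom₁ : ∀ x : ℝ, x < xs → F x ≤ Fh x)
    (hdom₂ : ∀ x : ℝ, xs ≤ x → Fh x ≤ F x)
    (h : ℝ → ℝ) (hbdd : ∃ C : ℝ, ∀ x, h x ≤ C)
    (hnonneg : ∀ x, 0 ≤ h x) (hanti : Antitone h) :
    ∫ x in Set.Iio xs, h x ∂μ ≤ ∫ x in Set.Iio xs, h x ∂ν := by
  have hle : ∀ x : ℝ, x < xs → μ (Set.Iic x) ≤ ν (Set.Iic x) := by
    intro x hx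
    have := hdom₁ x hx
    rw [hF, hFh] at this
    exact (ENNReal.toReal_le_toReal (measure_ne_top _ _) (measure_ne_top _ _)).1 this
  obtain ⟨C, hC⟩ := hbdd
  have hmeas : Measurable h := hanti.measurable
  have hnn : ∀ m : Measure ℝ, 0 ≤ᵐ[m] h := fun m => Filter.Eventually.of_forall hnonneg
  rw [integral_eq_lintegral_of_nonneg_ae (hnn _) hmeas.aestronglyMeasurable,
    integral_eq_lintegral_of_nonneg_ae (hnn _) hmeas.aestronglyMeasurable]
  apply ENNReal.toReal_mono
  · have hint : Integrable h (ν.restrict (Set.Iio xs)) := by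
      refine Integrable.of_bound hmeas.aestronglyMeasurable C (Filter.Eventually.of_forall ?_)
      intro x
      rw [Real.norm_of_nonneg (hnonneg x)]
      exact hC x
    exact hint.lintegral_lt_top.ne
  · rw [lintegral_eq_lintegral_meas_le _ (hnn _) hmeas.aemeasurable,
      lintegral_eq_lintegral_meas_le _ (hnn _) hmeas.aemeasurable]
    apply lintegral_mono
    intro t
    have hms : MeasurableSet {a | t ≤ h a} := measurableSet_le measurable_const hmeas
    simp only [Measure.restrict_apply hms]
    apply measure_lower_le μ ν xs hle
    · intro a b hba ha
      exact ⟨le_trans ha.1 (hanti hba), lt_of_le_of_lt hba ha.2⟩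
    · exact Set.inter_subset_right
end

section
/- Let μ and μ̂ be probability measures on ℝ with CDFs F and F̂, let x* ∈ ℝ, and suppose μ̂ dominates μ in polarization around x*. Let h : ℝ → ℝ be a bounded, nonnegative, nondecreasing function. Then ∫_{(x*,∞)} h(x) dμ(x) ≤ ∫_{(x*,∞)} h(x) dμ̂(x). -/
open MeasureTheory

theorem measure_Ioi_le_aux (μ ν : Measure ℝ) [IsProbabilityMeasure μ] [IsProbabilityMeasure ν]
    (x : ℝ) (hx : ν (Set.Iic x) ≤ μ (Set.Iic x)) : μ (Set.Ioi x) ≤ ν (Set.Ioi x) := by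
  rw [← Set.compl_Iic, prob_compl_eq_one_sub measurableSet_Iic,
    prob_compl_eq_one_sub measurableSet_Iic]
  exact tsub_le_tsub_left hx 1

theorem measure_Ici_le_aux (μ ν : Measure ℝ) [IsProbabilityMeasure μ] [IsProbabilityMeasure ν]
    (xs a : ℝ) (ha : xs < a) (hx : ∀ x, xs ≤ x → ν (Set.Iic x) ≤ μ (Set.Iic x)) :
    μ (Set.Ici a) ≤ ν (Set.Ici a) := by
  obtain ⟨u, hu, hmem, hlim⟩ := exists_seq_strictMono_tendsto' ha
  have hU : ⋃ n, Set.Iic (u n) = Set.Iio a :=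
    iUnion_Iic_eq_Iio_of_lt_of_tendsto (fun n => (hmem n).2) hlim
  have hm : Monotone fun n => Set.Iic (u n) := fun m n hmn => Set.Iic_subset_Iic.2 (hu.monotone hmn)
  have h1 := tendsto_measure_iUnion_atTop (μ := μ) hm
  have h2 := tendsto_measure_iUnion_atTop (μ := ν) hm
  rw [hU] at h1 h2
  have h3 : ν (Set.Iio a) ≤ μ (Set.Iio a) :=
    le_of_tendsto_of_tendsto' h2 h1 fun n => hx _ (hmem n).1.le
  rw [← Set.compl_Iio, prob_compl_eq_one_sub measurableSet_Iio,
    prob_compl_eq_one_sub measurableSet_Iio]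
  exact tsub_le_tsub_left h3 1

theorem measure_upper_le_aux (μ ν : Measure ℝ) [IsProbabilityMeasure μ] [IsProbabilityMeasure ν]
    (xs : ℝ) (hx : ∀ x, xs ≤ x → ν (Set.Iic x) ≤ μ (Set.Iic x))
    (S : Set ℝ) (hS : IsUpperSet S) (hsub : S ⊆ Set.Ioi xs) : μ S ≤ ν S := by
  rcases S.eq_empty_or_nonempty with rfl | hne
  · simp
  have hb : BddBelow S := ⟨xs, fun y hy => (hsub hy).le⟩
  have hle : xs ≤ sInf S := le_csInf hne fun y hy => (hsub hy).le
  by_cases hmem : sInf S ∈ S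
  · have : S = Set.Ici (sInf S) :=
      Set.Subset.antisymm (fun y hy => csInf_le hb hy) (fun y hy => hS hy hmem)
    rw [this]
    exact measure_Ici_le_aux μ ν xs _ (hsub hmem) hx
  · have : S = Set.Ioi (sInf S) := by
      refine Set.Subset.antisymm (fun y hy => ?_) (fun y hy => ?_)
      · exact lt_of_le_of_ne (csInf_le hb hy) (fun e => hmem (e ▸ hy))
      · obtain ⟨z, hz, hzy⟩ := exists_lt_of_csInf_lt hne hy
        exact hS hzy.le hz
    rw [this]
    exact measure_Ioi_le_aux μ ν _ (hx _ hle)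

/-- If `ν` dominates `μ` in polarization around `xs`, and
`h : ℝ → ℝ` is bounded, nonnegative and nondecreasing, then the integral of `h`
over `(xs, ∞)` with respect to `μ` is at most that with respect to `ν`. -/
theorem integral_right_le_of_dominates
    (μ ν : Measure ℝ) [IsProbabilityMeasure μ] [IsProbabilityMeasure ν]
    (xs : ℝ) (F Fh : ℝ → ℝ)
    (hF : ∀ x, F x = (μ (Set.Iic x)).toReal)
    (hFh : ∀ x, Fh x = (ν (Set.Iic x)).toReal)
    (hdom₁ : ∀ x : ℝ, x < xs → F x ≤ Fh x)
    (hdom₂ : ∀ x : ℝ, xs ≤ x → Fh x ≤ F x)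
    (h : ℝ → ℝ) (hbdd : ∃ C : ℝ, ∀ x, h x ≤ C)
    (hnonneg : ∀ x, 0 ≤ h x) (hmono : Monotone h) :
    ∫ x in Set.Ioi xs, h x ∂μ ≤ ∫ x in Set.Ioi xs, h x ∂ν := by
  have hx : ∀ x, xs ≤ x → ν (Set.Iic x) ≤ μ (Set.Iic x) := fun x hx => by
    have := hdom₂ x hx
    rw [hF, hFh] at this
    exact (ENNReal.toReal_le_toReal (measure_ne_top _ _) (measure_ne_top _ _)).1 this
  obtain ⟨C, hC⟩ := hbdd
  have hint : Integrable h ν := Integrable.of_bound hmono.measurable.aestronglyMeasurable C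
    (Filter.Eventually.of_forall fun x => by
      rw [Real.norm_eq_abs, abs_of_nonneg (hnonneg x)]; exact hC x)
  rw [integral_eq_lintegral_of_nonneg_ae (Filter.Eventually.of_forall hnonneg)
      hmono.measurable.aestronglyMeasurable,
    integral_eq_lintegral_of_nonneg_ae (Filter.Eventually.of_forall hnonneg)
      hmono.measurable.aestronglyMeasurable]
  refine ENNReal.toReal_mono (Integrable.lintegral_lt_top hint.integrableOn).ne ?_
  rw [lintegral_eq_lintegral_meas_le _ (Filter.Eventually.of_forall hnonneg)
      hmono.measurable.aemeasurable,
    lintegral_eq_lintegral_meas_le _ (Filter.Eventually.of_forall hnonneg)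
      hmono.measurable.aemeasurable]
  refine lintegral_mono fun t => ?_
  have hms : MeasurableSet {a : ℝ | t ≤ h a} := measurableSet_le measurable_const hmono.measurable
  simp only [Measure.restrict_apply hms]
  refine measure_upper_le_aux μ ν xs hx _ ?_ Set.inter_subset_right
  exact fun a b hab ha => ⟨le_trans ha.1 (hmono hab), lt_of_lt_of_le ha.2 hab⟩
end

section
/- Let μ and μ̂ be probability measures on ℝ supported in a compact interval [a,b], let x* ∈ (a,b), and suppose μ̂ dominates μ in polarization around x*. Assume μ({x*}) = 0, μ((-∞,x*)) > 0, and μ((x*,∞)) > 0. For a probability measure ν define the group means m_L(ν) = (∫_{(-∞,x*)} x dν)/ν((-∞,x*)) and m_R(ν) = (∫_{(x*,∞)} x dν)/ν((x*,∞)). Then m_L(μ̂) ≤ m_L(μ) and m_R(μ̂) ≥ m_R(μ). -/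
open MeasureTheory

/-- Mean position of the left group (voters with position `x < xs`) under `ν`. -/
noncomputable def groupMeanL (xs : ℝ) (ν : Measure ℝ) : ℝ :=
  (∫ x in Set.Iio xs, x ∂ν) / (ν (Set.Iio xs)).toReal

/-- Mean position of the right group (voters with position `x > xs`) under `ν`. -/
noncomputable def groupMeanR (xs : ℝ) (ν : Measure ℝ) : ℝ :=
  (∫ x in Set.Ioi xs, x ∂ν) / (ν (Set.Ioi xs)).toReal

lemma gm_integral_mono (μ ν : Measure ℝ) (f : ℝ → ℝ) (hf : Measurable f) (h0 : ∀ x, 0 ≤ f x)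
    (hi : Integrable f ν)
    (h : ∫⁻ x, ENNReal.ofReal (f x) ∂μ ≤ ∫⁻ x, ENNReal.ofReal (f x) ∂ν) :
    ∫ x, f x ∂μ ≤ ∫ x, f x ∂ν := by
  rw [integral_eq_lintegral_of_nonneg_ae (Filter.Eventually.of_forall h0) hf.aestronglyMeasurable,
    integral_eq_lintegral_of_nonneg_ae (Filter.Eventually.of_forall h0) hf.aestronglyMeasurable]
  refine ENNReal.toReal_mono ?_ h
  have := hi.lintegral_lt_top
  exact this.ne

lemma gm_integrable (μ : Measure ℝ) [IsProbabilityMeasure μ] (a b : ℝ)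
    (h : μ (Set.Icc a b)ᶜ = 0) : Integrable (fun x : ℝ => x) μ := by
  refine Integrable.of_bound (C := max |a| |b|) measurable_id.aestronglyMeasurable ?_
  have : ∀ᵐ x ∂μ, x ∈ Set.Icc a b := h
  filter_upwards [this] with x hx
  exact abs_le_max_abs_abs hx.1 hx.2

lemma gm_left (μ : Measure ℝ) [IsProbabilityMeasure μ] (xs : ℝ)
    (h : Integrable (fun x : ℝ => x) μ) :
    ∫ x, max (xs - x) 0 ∂μ = xs * (μ (Set.Iio xs)).toReal - ∫ x in Set.Iio xs, x ∂μ := by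
  have e : (fun x => max (xs - x) 0) = (Set.Iio xs).indicator (fun x => xs - x) := by
    funext x
    by_cases hx : x < xs
    · rw [Set.indicator_of_mem (by exact hx), max_eq_left (by linarith)]
    · rw [Set.indicator_of_notMem (by exact hx), max_eq_right (by linarith)]
  rw [e, integral_indicator measurableSet_Iio, integral_sub (integrable_const _) h.integrableOn]
  simp [Measure.real, mul_comm]

lemma gm_right (μ : Measure ℝ) [IsProbabilityMeasure μ] (xs : ℝ)
    (h : Integrable (fun x : ℝ => x) μ) :
    ∫ x, max (x - xs) 0 ∂μ = (∫ x in Set.Ioi xs, x ∂μ) - xs * (μ (Set.Ioi xs)).toReal := by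
  have e : (fun x => max (x - xs) 0) = (Set.Ioi xs).indicator (fun x => x - xs) := by
    funext x
    by_cases hx : xs < x
    · rw [Set.indicator_of_mem (by exact hx), max_eq_left (by linarith)]
    · rw [Set.indicator_of_notMem (by exact hx), max_eq_right (by linarith)]
  rw [e, integral_indicator measurableSet_Ioi, integral_sub h.integrableOn (integrable_const _)]
  simp [Measure.real, mul_comm]

lemma gm_Iio (μ ν : Measure ℝ) (xs : ℝ) (h : ∀ x < xs, μ (Set.Iic x) ≤ ν (Set.Iic x)) :
    μ (Set.Iio xs) ≤ ν (Set.Iio xs) := by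
  obtain ⟨u, hu, hlt, ht⟩ := exists_seq_strictMono_tendsto xs
  rw [← iUnion_Iic_eq_Iio_of_lt_of_tendsto hlt ht]
  have hm : Monotone (fun n => Set.Iic (u n)) := fun i j hij => Set.Iic_subset_Iic.2 (hu.monotone hij)
  rw [hm.measure_iUnion, hm.measure_iUnion]
  exact iSup_mono fun n => h _ (hlt n)

/-- If `ν` dominates `μ` in polarization around `xs`, both measures
are supported in `[a,b]`, `μ` has no atom at `xs`, and both sides of `xs` carry
positive mass under `μ`, then the left group mean weakly decreases and the right
group mean weakly increases when passing from `μ` to `ν`. -/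
theorem groupMeans_of_dominates
    (μ ν : Measure ℝ) [IsProbabilityMeasure μ] [IsProbabilityMeasure ν]
    (a b xs : ℝ) (hab : a < b) (hxs : xs ∈ Set.Ioo a b)
    (hsuppμ : μ (Set.Icc a b)ᶜ = 0) (hsuppν : ν (Set.Icc a b)ᶜ = 0)
    (F Fh : ℝ → ℝ)
    (hF : ∀ x, F x = (μ (Set.Iic x)).toReal)
    (hFh : ∀ x, Fh x = (ν (Set.Iic x)).toReal)
    (hdom₁ : ∀ x : ℝ, x < xs → F x ≤ Fh x)
    (hdom₂ : ∀ x : ℝ, xs ≤ x → Fh x ≤ F x)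
    (hatom : μ {xs} = 0)
    (hL : 0 < μ (Set.Iio xs)) (hR : 0 < μ (Set.Ioi xs)) :
    groupMeanL xs ν ≤ groupMeanL xs μ ∧ groupMeanR xs μ ≤ groupMeanR xs ν := by
  have h1 : ∀ x < xs, μ (Set.Iic x) ≤ ν (Set.Iic x) := fun x hx => by
    have := hdom₁ x hx
    rw [hF, hFh] at this
    exact (ENNReal.toReal_le_toReal (measure_ne_top _ _) (measure_ne_top _ _)).1 this
  have h2 : ∀ x, xs ≤ x → ν (Set.Iic x) ≤ μ (Set.Iic x) := fun x hx => by
    have := hdom₂ x hx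
    rw [hF, hFh] at this
    exact (ENNReal.toReal_le_toReal (measure_ne_top _ _) (measure_ne_top _ _)).1 this
  have h3 : ∀ x, xs ≤ x → μ (Set.Ioi x) ≤ ν (Set.Ioi x) := fun x hx => by
    rw [← Set.compl_Iic, prob_compl_eq_one_sub measurableSet_Iic,
      prob_compl_eq_one_sub measurableSet_Iic]
    exact tsub_le_tsub_left (h2 x hx) 1
  have hI := gm_Iio μ ν xs h1
  have hμ : μ (Set.Iic xs) = μ (Set.Iio xs) := by
    refine le_antisymm ?_ (measure_mono Set.Iio_subset_Iic_self)
    rw [← Set.Iio_union_right]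
    exact (measure_union_le _ _).trans (by rw [hatom, add_zero])
  have hν : ν (Set.Iio xs) ≤ ν (Set.Iic xs) := measure_mono Set.Iio_subset_Iic_self
  have hLe : ν (Set.Iio xs) = μ (Set.Iio xs) :=
    le_antisymm (hν.trans ((h2 xs le_rfl).trans hμ.le)) hI
  have hC : ν (Set.Iic xs) = μ (Set.Iic xs) :=
    le_antisymm (h2 xs le_rfl) (hμ.le.trans (hI.trans hν))
  have hRe : ν (Set.Ioi xs) = μ (Set.Ioi xs) := by
    rw [← Set.compl_Iic, prob_compl_eq_one_sub measurableSet_Iic,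
      prob_compl_eq_one_sub measurableSet_Iic, hC]
  have iμ := gm_integrable μ a b hsuppμ
  have iν := gm_integrable ν a b hsuppν
  unfold groupMeanL groupMeanR
  rw [hLe, hRe]
  constructor
  · refine div_le_div_of_nonneg_right ?_ ENNReal.toReal_nonneg
    have key := gm_integral_mono μ ν (fun x => max (xs - x) 0) (by fun_prop)
      (fun x => le_max_right _ _) (((integrable_const xs).sub iν).pos_part) (by
        rw [lintegral_eq_lintegral_meas_le μ (f := fun x => max (xs - x) 0)
            (Filter.Eventually.of_forall fun x => le_max_right _ _) (by fun_prop),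
          lintegral_eq_lintegral_meas_le ν (f := fun x => max (xs - x) 0)
            (Filter.Eventually.of_forall fun x => le_max_right _ _) (by fun_prop)]
        refine setLIntegral_mono' measurableSet_Ioi fun t ht => ?_
        have ht : 0 < t := ht
        have e : {x : ℝ | t ≤ max (xs - x) 0} = Set.Iic (xs - t) := by
          ext x
          simp only [Set.mem_setOf_eq, Set.mem_Iic, le_max_iff]
          constructor
          · rintro (h | h) <;> linarith
          · intro h; left; linarith
        rw [e]
        exact h1 _ (by linarith))
    rw [gm_left μ xs iμ, gm_left ν xs iν, hLe] at key
    linarith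
  · refine div_le_div_of_nonneg_right ?_ ENNReal.toReal_nonneg
    have key := gm_integral_mono μ ν (fun x => max (x - xs) 0) (by fun_prop)
      (fun x => le_max_right _ _) ((iν.sub (integrable_const xs)).pos_part) (by
        rw [lintegral_eq_lintegral_meas_lt μ (f := fun x => max (x - xs) 0)
            (Filter.Eventually.of_forall fun x => le_max_right _ _) (by fun_prop),
          lintegral_eq_lintegral_meas_lt ν (f := fun x => max (x - xs) 0)
            (Filter.Eventually.of_forall fun x => le_max_right _ _) (by fun_prop)]
        refine setLIntegral_mono' measurableSet_Ioi fun t ht => ?_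
        have ht : 0 < t := ht
        have e : {x : ℝ | t < max (x - xs) 0} = Set.Ioi (xs + t) := by
          ext x
          simp only [Set.mem_setOf_eq, Set.mem_Ioi, lt_max_iff]
          constructor
          · rintro (h | h) <;> linarith
          · intro h; left; linarith
        rw [e]
        exact h3 _ (by linarith))
    rw [gm_right μ xs iμ, gm_right ν xs iν, hRe] at key
    linarith
end

section
/- Let μ and μ̂ be probability measures on ℝ supported in a compact interval [a,b], let x* ∈ (a,b), and suppose μ̂ dominates μ in polarization around x*. Assume μ({x*}) = 0, μ((-∞,x*)) > 0, and μ((x*,∞)) > 0. Let g : ℝ → ℝ be nondecreasing. For a probability measure ν define the group means m_L(ν) = (∫_{(-∞,x*)} x dν)/ν((-∞,x*)) and m_R(ν) = (∫_{(x*,∞)} x dν)/ν((x*,∞)), and the level of affective polarization A(ν) = ∫_{(-∞,x*)} g(m_R(ν) − x) dν(x) + ∫_{(x*,∞)} g(x − m_L(ν)) dν(x). Then A(μ̂) ≥ A(μ). -/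
open MeasureTheory

/-- The level of affective polarization: the population-average animosity, where a
voter at `x` in one group feels animosity `g` of the distance between `x` and the
mean position of the opposing group. -/
noncomputable def affectivePolarization (xs : ℝ) (g : ℝ → ℝ) (ν : Measure ℝ) : ℝ :=
  (∫ x in Set.Iio xs, g (groupMeanR xs ν - x) ∂ν) +
    ∫ x in Set.Ioi xs, g (x - groupMeanL xs ν) ∂ν

lemma aux_integrable (P : Measure ℝ) [IsFiniteMeasure P] (a b : ℝ)
    (hP : P (Set.Icc a b)ᶜ = 0) (f : ℝ → ℝ) (hf : Monotone f) : Integrable f P := by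
  refine Integrable.of_bound hf.measurable.aestronglyMeasurable (max |f a| |f b|) ?_
  have h : ∀ᵐ x ∂P, x ∈ Set.Icc a b := by
    rw [ae_iff]; exact hP
  filter_upwards [h] with x hx
  rw [Real.norm_eq_abs]
  exact abs_le_max_abs_abs (hf hx.1) (hf hx.2)

lemma aux_Iio (P Q : Measure ℝ) (y : ℝ)
    (h : ∀ x < y, Q (Set.Iic x) ≤ P (Set.Iic x)) : Q (Set.Iio y) ≤ P (Set.Iio y) := by
  obtain ⟨u, hu, hlt, hlim⟩ := exists_seq_strictMono_tendsto y
  have hU : ⋃ n, Set.Iic (u n) = Set.Iio y := iUnion_Iic_eq_Iio_of_lt_of_tendsto hlt hlim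
  have hm : Monotone fun n => Set.Iic (u n) := fun i j hij =>
    Set.Iic_subset_Iic.2 (hu.monotone hij)
  rw [← hU, hm.measure_iUnion, hm.measure_iUnion]
  exact iSup_mono fun n => h _ (hlt n)

lemma aux_lower (P Q : Measure ℝ) (hPQ : P Set.univ = Q Set.univ)
    (h : ∀ x, Q (Set.Iic x) ≤ P (Set.Iic x)) (S : Set ℝ) (hS : IsLowerSet S) :
    Q S ≤ P S := by
  rcases S.eq_empty_or_nonempty with rfl | hne
  · simp
  by_cases hb : BddAbove S
  · by_cases hm : sSup S ∈ S
    · have : S = Set.Iic (sSup S) :=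
        Set.Subset.antisymm (fun x hx => le_csSup hb hx) (fun x hx => hS hx hm)
      rw [this]; exact h _
    · have : S = Set.Iio (sSup S) := by
        apply Set.Subset.antisymm
        · intro x hx
          exact lt_of_le_of_ne (le_csSup hb hx) (fun e => hm (e ▸ hx))
        · intro x hx
          obtain ⟨y, hy, hxy⟩ := exists_lt_of_lt_csSup hne hx
          exact hS hxy.le hy
      rw [this]; exact aux_Iio P Q _ fun x _ => h x
  · have : S = Set.univ := by
      apply Set.eq_univ_of_forall
      intro x
      obtain ⟨y, hy, hxy⟩ := not_bddAbove_iff.1 hb x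
      exact hS hxy.le hy
    rw [this, hPQ]

lemma aux_upper (P Q : Measure ℝ) [IsFiniteMeasure P] [IsFiniteMeasure Q]
    (hPQ : P Set.univ = Q Set.univ)
    (h : ∀ x, Q (Set.Iic x) ≤ P (Set.Iic x)) (S : Set ℝ) (hS : IsUpperSet S) :
    P S ≤ Q S := by
  have hm : MeasurableSet S := hS.ordConnected.measurableSet
  have h1 := aux_lower P Q hPQ h Sᶜ hS.compl
  have h2 := measure_compl hm.compl (measure_ne_top P Sᶜ)
  have h3 := measure_compl hm.compl (measure_ne_top Q Sᶜ)
  rw [compl_compl] at h2 h3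
  rw [h2, h3, hPQ]
  exact tsub_le_tsub_left h1 _

lemma aux_dom (P Q : Measure ℝ) [IsFiniteMeasure P] [IsFiniteMeasure Q]
    (hPQ : P Set.univ = Q Set.univ)
    (h : ∀ x, Q (Set.Iic x) ≤ P (Set.Iic x)) (a b : ℝ)
    (hP : P (Set.Icc a b)ᶜ = 0) (hQ : Q (Set.Icc a b)ᶜ = 0)
    (f : ℝ → ℝ) (hf : Monotone f) : ∫ x, f x ∂P ≤ ∫ x, f x ∂Q := by
  set k : ℝ → ℝ := fun x => f (max a x) - f a with hk
  have hkm : Monotone k := fun x y hxy =>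
    sub_le_sub_right (hf (max_le_max le_rfl hxy)) _
  have hk0 : ∀ x, 0 ≤ k x := fun x => sub_nonneg.2 (hf (le_max_left _ _))
  have key : ∀ M : Measure ℝ, IsFiniteMeasure M → M (Set.Icc a b)ᶜ = 0 →
      ∫ x, f x ∂M = ∫ x, k x ∂M + M.real Set.univ * f a := by
    intro M _ hR
    have e : ∫ x, f x ∂M = ∫ x, (k x + f a) ∂M := by
      apply integral_congr_ae
      have h : ∀ᵐ x ∂M, x ∈ Set.Icc a b := by
        rw [ae_iff]; exact hR
      filter_upwards [h] with x hx
      simp [hk, max_eq_right hx.1]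
    rw [e, integral_add (aux_integrable M a b hR k hkm) (integrable_const _)]
    simp
  have hu : P.real Set.univ = Q.real Set.univ := by simp [Measure.real, hPQ]
  rw [key P inferInstance hP, key Q inferInstance hQ, hu]
  gcongr ?_ + _
  rw [integral_eq_lintegral_of_nonneg_ae (.of_forall hk0) hkm.measurable.aestronglyMeasurable,
    integral_eq_lintegral_of_nonneg_ae (.of_forall hk0) hkm.measurable.aestronglyMeasurable]
  apply ENNReal.toReal_mono
  · have := (aux_integrable Q a b hQ k hkm).lintegral_lt_top
    exact this.ne
  rw [lintegral_eq_lintegral_meas_lt P (.of_forall hk0) hkm.measurable.aemeasurable,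
    lintegral_eq_lintegral_meas_lt Q (.of_forall hk0) hkm.measurable.aemeasurable]
  apply lintegral_mono
  intro t
  apply aux_upper P Q hPQ h
  intro x y hxy hx
  exact lt_of_lt_of_le hx (hkm hxy)

lemma aux_integrable_anti (P : Measure ℝ) [IsFiniteMeasure P] (a b : ℝ)
    (hP : P (Set.Icc a b)ᶜ = 0) (f : ℝ → ℝ) (hf : Antitone f) : Integrable f P := by
  have := (aux_integrable P a b hP (fun x => - f x) (fun x y h => neg_le_neg (hf h))).neg
  simpa [Pi.neg_def] using this

lemma aux_dom_anti (P Q : Measure ℝ) [IsFiniteMeasure P] [IsFiniteMeasure Q]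
    (hPQ : P Set.univ = Q Set.univ)
    (h : ∀ x, Q (Set.Iic x) ≤ P (Set.Iic x)) (a b : ℝ)
    (hP : P (Set.Icc a b)ᶜ = 0) (hQ : Q (Set.Icc a b)ᶜ = 0)
    (f : ℝ → ℝ) (hf : Antitone f) : ∫ x, f x ∂Q ≤ ∫ x, f x ∂P := by
  have := aux_dom P Q hPQ h a b hP hQ (fun x => - f x) (fun x y h => neg_le_neg (hf h))
  rw [integral_neg, integral_neg] at this
  exact neg_le_neg_iff.1 this

/-- If `ν` dominates `μ` in polarization around `xs` (with both
measures supported in `[a,b]`, no `μ`-atom at `xs`, and positive `μ`-mass on each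
side of `xs`), then for any nondecreasing animosity function `g`, affective
polarization under `ν` is at least that under `μ`. -/
theorem affectivePolarization_le_of_dominates
    (μ ν : Measure ℝ) [IsProbabilityMeasure μ] [IsProbabilityMeasure ν]
    (a b xs : ℝ) (hab : a < b) (hxs : xs ∈ Set.Ioo a b)
    (hsuppμ : μ (Set.Icc a b)ᶜ = 0) (hsuppν : ν (Set.Icc a b)ᶜ = 0)
    (F Fh : ℝ → ℝ)
    (hF : ∀ x, F x = (μ (Set.Iic x)).toReal)
    (hFh : ∀ x, Fh x = (ν (Set.Iic x)).toReal)
    (hdom₁ : ∀ x : ℝ, x < xs → F x ≤ Fh x)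
    (hdom₂ : ∀ x : ℝ, xs ≤ x → Fh x ≤ F x)
    (hatom : μ {xs} = 0)
    (hL : 0 < μ (Set.Iio xs)) (hR : 0 < μ (Set.Ioi xs))
    (g : ℝ → ℝ) (hg : Monotone g) :
    affectivePolarization xs g μ ≤ affectivePolarization xs g ν := by
  have h1 : ∀ x < xs, μ (Set.Iic x) ≤ ν (Set.Iic x) := fun x hx => by
    have := hdom₁ x hx
    rw [hF, hFh] at this
    exact (ENNReal.toReal_le_toReal (measure_ne_top _ _) (measure_ne_top _ _)).1 this
  have h2 : ∀ x, xs ≤ x → ν (Set.Iic x) ≤ μ (Set.Iic x) := fun x hx => by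
    have := hdom₂ x hx
    rw [hF, hFh] at this
    exact (ENNReal.toReal_le_toReal (measure_ne_top _ _) (measure_ne_top _ _)).1 this
  have h3 : μ (Set.Iio xs) ≤ ν (Set.Iio xs) := aux_Iio ν μ xs h1
  have h4 : μ (Set.Iic xs) = μ (Set.Iio xs) := by
    apply le_antisymm _ (measure_mono Set.Iio_subset_Iic_self)
    rw [← Set.Iio_union_right]
    exact (measure_union_le _ _).trans (by rw [hatom, add_zero])
  have h5 : ν (Set.Iio xs) ≤ ν (Set.Iic xs) := measure_mono Set.Iio_subset_Iic_self
  have h6 := h2 xs le_rfl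
  have eL : ν (Set.Iio xs) = μ (Set.Iio xs) :=
    le_antisymm (h5.trans (h6.trans h4.le)) h3
  have eI : ν (Set.Iic xs) = μ (Set.Iic xs) :=
    le_antisymm h6 (h4.le.trans (h3.trans h5))
  have eR : ν (Set.Ioi xs) = μ (Set.Ioi xs) := by
    rw [← Set.compl_Iic, prob_compl_eq_one_sub measurableSet_Iic,
      prob_compl_eq_one_sub measurableSet_Iic, eI]
  have sup : ∀ (M : Measure ℝ) (s : Set ℝ), M (Set.Icc a b)ᶜ = 0 →
      M.restrict s (Set.Icc a b)ᶜ = 0 := fun M s hR =>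
    le_antisymm ((Measure.restrict_apply_le _ _).trans hR.le) bot_le
  have dL : ∀ x, μ.restrict (Set.Iio xs) (Set.Iic x) ≤ ν.restrict (Set.Iio xs) (Set.Iic x) := by
    intro x
    rw [Measure.restrict_apply measurableSet_Iic, Measure.restrict_apply measurableSet_Iic]
    rcases lt_or_ge x xs with hx | hx
    · have : Set.Iic x ∩ Set.Iio xs = Set.Iic x :=
        Set.inter_eq_left.2 fun y hy => lt_of_le_of_lt hy hx
      rw [this]; exact h1 x hx
    · have : Set.Iic x ∩ Set.Iio xs = Set.Iio xs :=
        Set.inter_eq_right.2 fun y hy => (le_of_lt hy).trans hx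
      rw [this]; exact h3
  have dR : ∀ x, ν.restrict (Set.Ioi xs) (Set.Iic x) ≤ μ.restrict (Set.Ioi xs) (Set.Iic x) := by
    intro x
    rw [Measure.restrict_apply measurableSet_Iic, Measure.restrict_apply measurableSet_Iic]
    rcases lt_or_ge x xs with hx | hx
    · have : Set.Iic x ∩ Set.Ioi xs = ∅ := by
        ext y
        simp only [Set.mem_inter_iff, Set.mem_Iic, Set.mem_Ioi, Set.mem_empty_iff_false, iff_false]
        rintro ⟨p, q⟩
        linarith
      rw [this]; simp
    · have : Set.Iic x ∩ Set.Ioi xs = Set.Iic x \ Set.Iic xs := by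
        rw [Set.sdiff_eq, Set.compl_Iic]
      rw [this, measure_sdiff (Set.Iic_subset_Iic.2 hx) measurableSet_Iic.nullMeasurableSet
        (measure_ne_top _ _), measure_sdiff (Set.Iic_subset_Iic.2 hx)
        measurableSet_Iic.nullMeasurableSet (measure_ne_top _ _), eI]
      exact tsub_le_tsub_right (h2 x hx) _
  have tL : ν.restrict (Set.Iio xs) Set.univ = μ.restrict (Set.Iio xs) Set.univ := by
    simpa using eL
  have tR : μ.restrict (Set.Ioi xs) Set.univ = ν.restrict (Set.Ioi xs) Set.univ := by
    simpa using eR.symm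
  have mL : groupMeanL xs ν ≤ groupMeanL xs μ := by
    unfold groupMeanL
    rw [eL]
    exact div_le_div_of_nonneg_right (aux_dom _ _ tL dL a b (sup _ _ hsuppν) (sup _ _ hsuppμ)
      (fun x => x) monotone_id) ENNReal.toReal_nonneg
  have mR : groupMeanR xs μ ≤ groupMeanR xs ν := by
    unfold groupMeanR
    rw [eR]
    exact div_le_div_of_nonneg_right (aux_dom _ _ tR dR a b (sup _ _ hsuppμ) (sup _ _ hsuppν)
      (fun x => x) monotone_id) ENNReal.toReal_nonneg
  have anti : ∀ m, Antitone fun x => g (m - x) := fun m x y h => hg (by linarith)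
  have mono : ∀ m, Monotone fun x => g (x - m) := fun m x y h => hg (by linarith)
  unfold affectivePolarization
  apply add_le_add
  · refine (aux_dom_anti _ _ tL dL a b (sup _ _ hsuppν) (sup _ _ hsuppμ) _ (anti _)).trans ?_
    exact integral_mono (aux_integrable_anti _ a b (sup _ _ hsuppν) _ (anti _))
      (aux_integrable_anti _ a b (sup _ _ hsuppν) _ (anti _)) fun x => hg (by linarith)
  · refine (aux_dom _ _ tR dR a b (sup _ _ hsuppμ) (sup _ _ hsuppν) _ (mono _)).trans ?_
    exact integral_mono (aux_integrable _ a b (sup _ _ hsuppν) _ (mono _))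
      (aux_integrable _ a b (sup _ _ hsuppν) _ (mono _)) fun x => hg (by linarith)
end

section
/- Let ν be a probability measure on ℝ (the distribution of positions d on the divisive issue), let c₀ ∈ ℝ, and for α ∈ (0,1] let μ_α be the pushforward of ν under the map x ↦ (1−α)c₀ + αx (the distribution of ideological positions when the common-value position is the constant c₀ and the divisive issue has salience α). Then for any 0 < α ≤ α' ≤ 1, the measure μ_{α'} dominates μ_α in polarization around c₀. -/
open MeasureTheory

/-- Let `ν` be the distribution of positions on the divisive issue,
let the common-value position be the constant `c₀`, and for salience `α` let
`μ_α` be the distribution of `(1-α)·c₀ + α·d`. Then for `0 < α ≤ α' ≤ 1`, the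
measure `μ_{α'}` dominates `μ_α` in polarization around `c₀`: the CDF of `μ_{α'}`
is weakly above that of `μ_α` to the left of `c₀` and weakly below it from `c₀`
on. -/
theorem salience_increases_polarization
    (ν : Measure ℝ) [IsProbabilityMeasure ν] (c₀ : ℝ)
    (α α' : ℝ) (hα : 0 < α) (hαα' : α ≤ α') (hα' : α' ≤ 1)
    (μα μα' : Measure ℝ)
    (hμα : μα = Measure.map (fun x => (1 - α) * c₀ + α * x) ν)
    (hμα' : μα' = Measure.map (fun x => (1 - α') * c₀ + α' * x) ν) :
    (∀ x : ℝ, x < c₀ → (μα (Set.Iic x)).toReal ≤ (μα' (Set.Iic x)).toReal) ∧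
      (∀ x : ℝ, c₀ ≤ x → (μα' (Set.Iic x)).toReal ≤ (μα (Set.Iic x)).toReal) := by
  subst hμα hμα'
  have hm : ∀ a : ℝ, Measurable (fun x : ℝ => (1 - a) * c₀ + a * x) := by
    intro a
    fun_prop
  constructor
  · intro x hx
    rw [Measure.map_apply (hm α) measurableSet_Iic, Measure.map_apply (hm α') measurableSet_Iic]
    refine ENNReal.toReal_mono (measure_ne_top _ _) (measure_mono ?_)
    intro d hd
    simp only [Set.mem_preimage, Set.mem_Iic] at hd ⊢
    have hdc : d < c₀ := by
      by_contra h
      push Not at h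
      nlinarith [mul_nonneg hα.le (sub_nonneg.2 h)]
    nlinarith [mul_nonneg (sub_nonneg.2 hαα') (sub_nonneg.2 hdc.le)]
  · intro x hx
    rw [Measure.map_apply (hm α) measurableSet_Iic, Measure.map_apply (hm α') measurableSet_Iic]
    refine ENNReal.toReal_mono (measure_ne_top _ _) (measure_mono ?_)
    intro d hd
    simp only [Set.mem_preimage, Set.mem_Iic] at hd ⊢
    rcases le_total c₀ d with h | h
    · nlinarith [mul_nonneg (sub_nonneg.2 hαα') (sub_nonneg.2 h)]
    · nlinarith [mul_nonneg hα.le (sub_nonneg.2 h)]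
end

section
/- Let c and d be independent real-valued random variables with c ∈ [c̲, c̄] almost surely, and for α ∈ (0,1] let F_α denote the CDF of X_α = (1−α)c + αd. Then for any 0 < α ≤ α' ≤ 1: (i) F_{α'}(x) ≥ F_α(x) for every x ≤ c̲, and (ii) F_{α'}(x) ≤ F_α(x) for every x ≥ c̄. -/
open MeasureTheory

/-- Let `c` and `d` be independent real random variables with
`c ∈ [cl, cu]` almost surely, and for salience `α` let `F_α` be the CDF of
`(1-α)·c + α·d`. Then for `0 < α ≤ α' ≤ 1`: (i) `F_{α'}(x) ≥ F_α(x)` for every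
`x ≤ cl`, and (ii) `F_{α'}(x) ≤ F_α(x)` for every `x ≥ cu`. -/
theorem salience_single_crossing
    {Ω : Type*} [MeasurableSpace Ω] (P : Measure Ω) [IsProbabilityMeasure P]
    (c d : Ω → ℝ) (hc : Measurable c) (hd : Measurable d)
    (hindep : ProbabilityTheory.IndepFun c d P)
    (cl cu : ℝ) (hcc : ∀ᵐ ω ∂P, c ω ∈ Set.Icc cl cu)
    (α α' : ℝ) (hα : 0 < α) (hαα' : α ≤ α') (hα' : α' ≤ 1) :
    (∀ x : ℝ, x ≤ cl →
      (P {ω | (1 - α) * c ω + α * d ω ≤ x}).toReal ≤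
        (P {ω | (1 - α') * c ω + α' * d ω ≤ x}).toReal) ∧
    (∀ x : ℝ, cu ≤ x →
      (P {ω | (1 - α') * c ω + α' * d ω ≤ x}).toReal ≤
        (P {ω | (1 - α) * c ω + α * d ω ≤ x}).toReal) := by
  constructor
  · intro x hx
    apply ENNReal.toReal_mono (measure_ne_top _ _)
    apply measure_mono_ae
    filter_upwards [hcc] with ω hω
    obtain ⟨h1, h2⟩ := hω
    intro (h : (1 - α) * c ω + α * d ω ≤ x)
    show (1 - α') * c ω + α' * d ω ≤ x
    have h3 : d ω - c ω ≤ 0 := by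
      by_contra hn
      push Not at hn
      nlinarith [mul_pos hα hn]
    nlinarith [mul_nonneg (sub_nonneg.2 hαα') (neg_nonneg.2 h3)]
  · intro x hx
    apply ENNReal.toReal_mono (measure_ne_top _ _)
    apply measure_mono_ae
    filter_upwards [hcc] with ω hω
    obtain ⟨h1, h2⟩ := hω
    intro (h : (1 - α') * c ω + α' * d ω ≤ x)
    show (1 - α) * c ω + α * d ω ≤ x
    rcases le_total (d ω - c ω) 0 with h3 | h3
    · nlinarith [mul_nonneg hα.le (neg_nonneg.2 h3)]
    · nlinarith [mul_nonneg (sub_nonneg.2 hαα') h3]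
end
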